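/- (Proposition 3: monotone improvement of the approximation algorithm.) Assume f_s ≥ 0 and c_s ≥ 0 componentwise for every stage s, λ_s ∈ [0,1] and α_s ∈ [0,1) for s = 2,…,T, p as specified, and every B_s with nonnegative entries. Let (x⁰, y⁰, η⁰, u⁰) be multistage-feasible. Suppose (x¹, η¹) is an optimal solution of SP-RMS(y⁰, u⁰), i.e. feasible for it and minimizing G over its feasible pairs, and suppose (y¹, u¹) minimizes ∑_{n∈𝒯} p_n ( c̃_n·y_n + α̃_n u_n ) over all (y, u) such that (x¹, y, η¹, u) is multistage-feasible. Then (x¹, y¹, η¹, u¹) is multistage-feasible and z^MS ≤ F(x¹, y¹, η¹, u¹) ≤ F(x⁰, y⁰, η⁰, u⁰), where z^MS is the infimum of F over multistage-feasible tuples. -/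

import Mathlib

open Finset

/-- A scenario tree with `T` stages: a finite nonempty set of nodes with a root,
a parent map fixing the root, a stage map decreasing by one along the parent map,
such that every node reaches the root by iterating the parent map, and every
non-leaf node has a child. -/
structure STree (T : ℕ) : Type 1 where
  Node : Type
  fin : Fintype Node
  deceq : DecidableEq Node
  root : Node
  parent : Node → Node
  stage : Node → ℕ
  hT : 1 ≤ T
  parent_root : parent root = root
  stage_root : stage root = 1
  stage_ge : ∀ n, 1 ≤ stage n
  stage_le : ∀ n, stage n ≤ T
  stage_parent : ∀ n, n ≠ root → stage (parent n) = stage n - 1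
  reaches_root : ∀ n, ∃ k, parent^[k] n = root
  children_ne : ∀ n, stage n ≠ T → ∃ m, m ≠ root ∧ parent m = n

attribute [instance] STree.fin STree.deceq

namespace STree

variable {T : ℕ} (S : STree T)

/-- The path set `𝒫(n) = {aᵏ(n) : k ≥ 0}` of a node. -/
def path (n : S.Node) : Finset S.Node :=
  (Finset.range T).image fun k => S.parent^[k] n

theorem path_nonempty (n : S.Node) : (S.path n).Nonempty :=
  ⟨n, Finset.mem_image.mpr ⟨0, Finset.mem_range.mpr S.hT, rfl⟩⟩

/-- The children `𝒞(n)` of a node. -/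
def children (n : S.Node) : Finset S.Node :=
  Finset.univ.filter fun m => m ≠ S.root ∧ S.parent m = n

theorem children_nonempty {n : S.Node} (h : S.stage n ≠ T) : (S.children n).Nonempty := by
  obtain ⟨m, h1, h2⟩ := S.children_ne n h
  exact ⟨m, Finset.mem_filter.mpr ⟨Finset.mem_univ m, h1, h2⟩⟩

/-- The set `𝒯ₛ` of stage-`s` nodes. -/
def stageNodes (s : ℕ) : Finset S.Node :=
  Finset.univ.filter fun n => S.stage n = s

theorem stageNodes_self_nonempty (n : S.Node) : (S.stageNodes (S.stage n)).Nonempty :=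
  ⟨n, Finset.mem_filter.mpr ⟨Finset.mem_univ n, rfl⟩⟩

end STree

section Constructions

variable {T M J : ℕ}

/-- `b_n = B_{τ(n)} ŷ_n` (componentwise). -/
noncomputable def bvec (S : STree T) (B : ℕ → Matrix (Fin M) (Fin J) ℝ)
    (yh : S.Node → Fin J → ℝ) (n : S.Node) (i : Fin M) : ℝ :=
  (B (S.stage n)).mulVec (yh n) i

/-- Componentwise maximum of `b` over all nodes of the same stage as `n`
(used for `b̄_n = max_{l ∈ 𝒯_{τ(n)}} b_l`). -/
noncomputable def stageMax (S : STree T) (b : S.Node → Fin M → ℝ) (n : S.Node) (i : Fin M) : ℝ :=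
  (S.stageNodes (S.stage n)).sup' (S.stageNodes_self_nonempty n) fun l => b l i

/-- `max_{m ∈ 𝒫(n)} ⌈b_m⌉` (componentwise). -/
noncomputable def pmc (S : STree T) (b : S.Node → Fin M → ℝ) (n : S.Node) (i : Fin M) : ℤ :=
  (S.path n).sup' (S.path_nonempty n) fun m => ⌈b m i⌉

/-- `max_{m ∈ 𝒫(n)} b_m` (componentwise, no rounding). -/
noncomputable def pm (S : STree T) (b : S.Node → Fin M → ℝ) (n : S.Node) (i : Fin M) : ℝ :=
  (S.path n).sup' (S.path_nonempty n) fun m => b m i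

end Constructions

section CapacityModel

variable {T M N J : ℕ}

/-- Multistage feasibility (with the capacity variables `x` taken real, for LP
relaxations; the integer model uses the coercion of an integer `x`). -/
def MFeasR (S : STree T) (f : ℕ → Fin M → ℝ) (c : ℕ → Fin J → ℝ)
    (A : ℕ → Matrix (Fin N) (Fin J) ℝ) (B : ℕ → Matrix (Fin M) (Fin J) ℝ)
    (d : S.Node → Fin N → ℝ)
    (x : S.Node → Fin M → ℝ) (y : S.Node → Fin J → ℝ) (η u : S.Node → ℝ) : Prop :=
  (∀ n i, 0 ≤ x n i) ∧ (∀ n j, 0 ≤ y n j) ∧ (∀ n, n ≠ S.root → 0 ≤ u n) ∧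
  (∀ n, (A (S.stage n)).mulVec (y n) = d n) ∧
  (∀ n i, (B (S.stage n)).mulVec (y n) i ≤ ∑ m ∈ S.path n, x m i) ∧
  ∀ n, n ≠ S.root →
    (∑ i, f (S.stage n) i * ∑ m ∈ S.path n, x m i) + (∑ j, c (S.stage n) j * y n j)
      ≤ u n + η (S.parent n)

/-- The two-stage (non-anticipativity) constraint: capacity decisions agree on
nodes of the same stage. -/
def TSconstr (S : STree T) (x : S.Node → Fin M → ℝ) : Prop :=
  ∀ m n, S.stage m = S.stage n → x m = x n

/-- The risk-averse objective
`F(x,y,η,u) = ∑_n p_n ( f̃_n·∑_{m∈𝒫(n)} x_m + c̃_n·y_n + λ̃_n η_n + α̃_n u_n )`,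
where `f̃, c̃, λ̃, α̃` are the derived ECRM coefficients. -/
noncomputable def FR (S : STree T) (p : S.Node → ℝ) (f : ℕ → Fin M → ℝ) (c : ℕ → Fin J → ℝ)
    (lam alpha : ℕ → ℝ)
    (x : S.Node → Fin M → ℝ) (y : S.Node → Fin J → ℝ) (η u : S.Node → ℝ) : ℝ :=
  ∑ n, p n *
    ((∑ i, (if n = S.root then f 1 i else (1 - lam (S.stage n)) * f (S.stage n) i)
        * ∑ m ∈ S.path n, x m i)
     + (∑ j, (if n = S.root then c 1 j else (1 - lam (S.stage n)) * c (S.stage n) j) * y n j)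
     + (if S.stage n = T then 0 else lam (S.stage n + 1)) * η n
     + (if n = S.root then 0 else lam (S.stage n) / (1 - alpha (S.stage n))) * u n)

/-- Optimal value of the risk-averse multistage model (integer capacities). -/
noncomputable def zMS (S : STree T) (p : S.Node → ℝ) (f : ℕ → Fin M → ℝ) (c : ℕ → Fin J → ℝ)
    (A : ℕ → Matrix (Fin N) (Fin J) ℝ) (B : ℕ → Matrix (Fin M) (Fin J) ℝ)
    (d : S.Node → Fin N → ℝ) (lam alpha : ℕ → ℝ) : ℝ :=
  sInf {v : ℝ | ∃ (x : S.Node → Fin M → ℤ) (y : S.Node → Fin J → ℝ) (η u : S.Node → ℝ),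
    MFeasR S f c A B d (fun n i => (x n i : ℝ)) y η u ∧
    v = FR S p f c lam alpha (fun n i => (x n i : ℝ)) y η u}

/-- Optimal value of the risk-averse two-stage model (integer capacities). -/
noncomputable def zTS (S : STree T) (p : S.Node → ℝ) (f : ℕ → Fin M → ℝ) (c : ℕ → Fin J → ℝ)
    (A : ℕ → Matrix (Fin N) (Fin J) ℝ) (B : ℕ → Matrix (Fin M) (Fin J) ℝ)
    (d : S.Node → Fin N → ℝ) (lam alpha : ℕ → ℝ) : ℝ :=
  sInf {v : ℝ | ∃ (x : S.Node → Fin M → ℤ) (y : S.Node → Fin J → ℝ) (η u : S.Node → ℝ),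
    MFeasR S f c A B d (fun n i => (x n i : ℝ)) y η u ∧
    TSconstr S (fun n i => (x n i : ℝ)) ∧
    v = FR S p f c lam alpha (fun n i => (x n i : ℝ)) y η u}

end CapacityModel

section Substructure

variable {T M J : ℕ}

/-- Feasibility for the substructure problem SP-RMS(ŷ,û). -/
def FeasSP (S : STree T) (f : ℕ → Fin M → ℝ) (c : ℕ → Fin J → ℝ)
    (B : ℕ → Matrix (Fin M) (Fin J) ℝ)
    (yh : S.Node → Fin J → ℝ) (uh : S.Node → ℝ)
    (x : S.Node → Fin M → ℤ) (η : S.Node → ℝ) : Prop :=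
  (∀ n i, 0 ≤ x n i) ∧
  (∀ n i, (B (S.stage n)).mulVec (yh n) i ≤ ∑ m ∈ S.path n, (x m i : ℝ)) ∧
  ∀ n, n ≠ S.root →
    (∑ i, f (S.stage n) i * ∑ m ∈ S.path n, (x m i : ℝ))
      + (∑ j, c (S.stage n) j * yh n j) - uh n ≤ η (S.parent n)

/-- Objective `G(x,η) = ∑_n p_n ( f̃_n · ∑_{m∈𝒫(n)} x_m + λ̃_n η_n )` of the
substructure problem, where `f̃` and `λ̃` are the derived coefficients. -/
noncomputable def Gobj (S : STree T) (p : S.Node → ℝ) (f : ℕ → Fin M → ℝ) (lam : ℕ → ℝ)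
    (x : S.Node → Fin M → ℤ) (η : S.Node → ℝ) : ℝ :=
  ∑ n, p n *
    ((∑ i, (if n = S.root then f 1 i else (1 - lam (S.stage n)) * f (S.stage n) i)
        * ∑ m ∈ S.path n, (x m i : ℝ))
     + (if S.stage n = T then 0 else lam (S.stage n + 1)) * η n)

end Substructure

namespace STree

variable {T : ℕ} (S : STree T)

theorem two_le_stage {n : S.Node} (h : n ≠ S.root) : 2 ≤ S.stage n := by
  have h1 := S.stage_parent n h
  have h2 := S.stage_ge (S.parent n)
  omega

theorem stage_eq_parent_add_one {n : S.Node} (h : n ≠ S.root) :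
    S.stage n = S.stage (S.parent n) + 1 := by
  have h1 := S.stage_parent n h
  have h2 := S.two_le_stage h
  omega

theorem sum_children (g : S.Node → ℝ) :
    ∑ n, ∑ m ∈ S.children n, g m = ∑ m with m ≠ S.root, g m := by
  rw [← Finset.sum_fiberwise (univ.filter fun m => m ≠ S.root) S.parent g]
  refine Finset.sum_congr rfl fun n _ => ?_
  rw [children, Finset.filter_filter]

/-- Moving a weighted sum over non-leaf nodes to the children of these nodes. -/
theorem sum_mul_eq_sum_parent (p : S.Node → ℝ)
    (hpc : ∀ n, S.stage n ≠ T → ∑ m ∈ S.children n, p m = p n)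
    (lam : ℕ → ℝ) (η : S.Node → ℝ) :
    ∑ n, p n * ((if S.stage n = T then 0 else lam (S.stage n + 1)) * η n)
      = ∑ n, if n = S.root then 0 else p n * (lam (S.stage n) * η (S.parent n)) := by
  have h : ∀ n, p n * ((if S.stage n = T then 0 else lam (S.stage n + 1)) * η n)
      = ∑ m ∈ S.children n, p m * (lam (S.stage m) * η (S.parent m)) := by
    intro n
    have hmem : ∀ m ∈ S.children n, m ≠ S.root ∧ S.parent m = n := fun m hm =>
      (Finset.mem_filter.mp hm).2
    by_cases hn : S.stage n = T
    · rw [if_pos hn, zero_mul, mul_zero]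
      refine (Finset.sum_eq_zero fun m hm => ?_).symm
      obtain ⟨hm1, hm2⟩ := hmem m hm
      have h1 := S.stage_eq_parent_add_one hm1
      have h2 := S.stage_le m
      rw [hm2] at h1
      omega
    · rw [if_neg hn, ← hpc n hn, Finset.sum_mul]
      refine Finset.sum_congr rfl fun m hm => ?_
      obtain ⟨hm1, hm2⟩ := hmem m hm
      rw [S.stage_eq_parent_add_one hm1, hm2]
  rw [Finset.sum_congr rfl fun n _ => h n, S.sum_children, Finset.sum_filter]
  exact Finset.sum_congr rfl fun n _ => by split_ifs <;> simp_all

end STree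

/-- The objective splits into the substructure objective and the `(y, u)`-part. -/
theorem FR_eq_Gobj_add {T M J : ℕ} (S : STree T) (p : S.Node → ℝ) (f : ℕ → Fin M → ℝ)
    (c : ℕ → Fin J → ℝ) (lam alpha : ℕ → ℝ) (x : S.Node → Fin M → ℤ)
    (y : S.Node → Fin J → ℝ) (η u : S.Node → ℝ) :
    FR S p f c lam alpha (fun n i => (x n i : ℝ)) y η u = Gobj S p f lam x η +
      ∑ n, p n * ((∑ j, (if n = S.root then c 1 j
                          else (1 - lam (S.stage n)) * c (S.stage n) j) * y n j)
          + (if n = S.root then 0 else lam (S.stage n) / (1 - alpha (S.stage n))) * u n) := by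
  rw [FR, Gobj, ← Finset.sum_add_distrib]
  exact Finset.sum_congr rfl fun n _ => by ring

/-- The objective is nonnegative on feasible tuples. -/
theorem FR_nonneg {T M N J : ℕ} (S : STree T)
    (p : S.Node → ℝ) (f : ℕ → Fin M → ℝ) (c : ℕ → Fin J → ℝ)
    (A : ℕ → Matrix (Fin N) (Fin J) ℝ) (B : ℕ → Matrix (Fin M) (Fin J) ℝ)
    (d : S.Node → Fin N → ℝ) (lam alpha : ℕ → ℝ)
    (hp : ∀ n, 0 ≤ p n)
    (hpc : ∀ n, S.stage n ≠ T → ∑ m ∈ S.children n, p m = p n)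
    (hf : ∀ s, 1 ≤ s → s ≤ T → ∀ i, 0 ≤ f s i)
    (hc : ∀ s, 1 ≤ s → s ≤ T → ∀ j, 0 ≤ c s j)
    (hlam : ∀ s, 2 ≤ s → s ≤ T → 0 ≤ lam s ∧ lam s ≤ 1)
    (halpha : ∀ s, 2 ≤ s → s ≤ T → 0 ≤ alpha s ∧ alpha s < 1)
    {x : S.Node → Fin M → ℝ} {y : S.Node → Fin J → ℝ} {η u : S.Node → ℝ}
    (h : MFeasR S f c A B d x y η u) :
    0 ≤ FR S p f c lam alpha x y η u := by
  obtain ⟨hx, hy, hu, -, -, hη⟩ := h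
  have hX : ∀ n i, 0 ≤ ∑ m ∈ S.path n, x m i := fun n i =>
    Finset.sum_nonneg fun m _ => hx m i
  have key : FR S p f c lam alpha x y η u = ∑ n, (p n *
      ((∑ i, (if n = S.root then f 1 i else (1 - lam (S.stage n)) * f (S.stage n) i)
          * ∑ m ∈ S.path n, x m i)
        + (∑ j, (if n = S.root then c 1 j
            else (1 - lam (S.stage n)) * c (S.stage n) j) * y n j))
      + (p n * ((if n = S.root then 0 else lam (S.stage n) / (1 - alpha (S.stage n))) * u n)
        + if n = S.root then 0 else p n * (lam (S.stage n) * η (S.parent n)))) := by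
    rw [Finset.sum_add_distrib, Finset.sum_add_distrib (f := fun n => p n * (_ * u n)),
      ← S.sum_mul_eq_sum_parent p hpc lam η, ← Finset.sum_add_distrib,
      ← Finset.sum_add_distrib, FR]
    exact Finset.sum_congr rfl fun n _ => by ring
  rw [key]
  refine Finset.sum_nonneg fun n _ => ?_
  by_cases hn : n = S.root
  · simp only [if_pos hn, zero_mul, mul_zero, add_zero]
    exact mul_nonneg (hp n) (add_nonneg
      (Finset.sum_nonneg fun i _ => mul_nonneg (hf 1 le_rfl S.hT i) (hX n i))
      (Finset.sum_nonneg fun j _ => mul_nonneg (hc 1 le_rfl S.hT j) (hy n j)))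
  · simp only [if_neg hn]
    have hfn := hf _ (S.stage_ge n) (S.stage_le n)
    have hcn := hc _ (S.stage_ge n) (S.stage_le n)
    obtain ⟨hl0, hl1⟩ := hlam _ (S.two_le_stage hn) (S.stage_le n)
    obtain ⟨ha0, ha1⟩ := halpha _ (S.two_le_stage hn) (S.stage_le n)
    have hun := hu n hn
    have hcost : 0 ≤ u n + η (S.parent n) := le_trans (add_nonneg
      (Finset.sum_nonneg fun i _ => mul_nonneg (hfn i) (hX n i))
      (Finset.sum_nonneg fun j _ => mul_nonneg (hcn j) (hy n j))) (hη n hn)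
    have hdiv : lam (S.stage n) ≤ lam (S.stage n) / (1 - alpha (S.stage n)) :=
      le_div_self hl0 (by linarith) (by linarith)
    have hrisk : 0 ≤ lam (S.stage n) / (1 - alpha (S.stage n)) * u n
        + lam (S.stage n) * η (S.parent n) := by
      nlinarith [mul_nonneg hl0 hcost, mul_le_mul_of_nonneg_right hdiv hun]
    rw [← mul_add (p n)]
    refine add_nonneg (mul_nonneg (hp n) (add_nonneg ?_ ?_)) (mul_nonneg (hp n) hrisk)
    · exact Finset.sum_nonneg fun i _ =>
        mul_nonneg (mul_nonneg (by linarith) (hfn i)) (hX n i)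
    · exact Finset.sum_nonneg fun j _ =>
        mul_nonneg (mul_nonneg (by linarith) (hcn j)) (hy n j)

/-- Proposition 3: one pass of the approximation algorithm
produces a multistage-feasible tuple whose objective value lies between the
multistage optimal value and the objective value of the starting tuple. -/
theorem approx_monotone_improvement {T M N J : ℕ} (S : STree T)
    (p : S.Node → ℝ) (f : ℕ → Fin M → ℝ) (c : ℕ → Fin J → ℝ)
    (A : ℕ → Matrix (Fin N) (Fin J) ℝ) (B : ℕ → Matrix (Fin M) (Fin J) ℝ)
    (d : S.Node → Fin N → ℝ) (lam alpha : ℕ → ℝ)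
    (hp : ∀ n, 0 ≤ p n)
    (hp1 : ∀ s, 1 ≤ s → s ≤ T → ∑ n ∈ S.stageNodes s, p n = 1)
    (hpc : ∀ n, S.stage n ≠ T → ∑ m ∈ S.children n, p m = p n)
    (hf : ∀ s, 1 ≤ s → s ≤ T → ∀ i, 0 ≤ f s i)
    (hc : ∀ s, 1 ≤ s → s ≤ T → ∀ j, 0 ≤ c s j)
    (hlam : ∀ s, 2 ≤ s → s ≤ T → 0 ≤ lam s ∧ lam s ≤ 1)
    (halpha : ∀ s, 2 ≤ s → s ≤ T → 0 ≤ alpha s ∧ alpha s < 1)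
    (hB : ∀ s, 1 ≤ s → s ≤ T → ∀ i j, 0 ≤ B s i j)
    -- the starting multistage-feasible tuple
    (x0 : S.Node → Fin M → ℤ) (y0 : S.Node → Fin J → ℝ) (eta0 u0 : S.Node → ℝ)
    (h0 : MFeasR S f c A B d (fun n i => (x0 n i : ℝ)) y0 eta0 u0)
    -- (x¹, η¹): an optimal solution of SP-RMS(y⁰, u⁰)
    (x1 : S.Node → Fin M → ℤ) (eta1 : S.Node → ℝ)
    (h1feas : FeasSP S f c B y0 u0 x1 eta1)
    (h1opt : ∀ x η, FeasSP S f c B y0 u0 x η →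
      Gobj S p f lam x1 eta1 ≤ Gobj S p f lam x η)
    -- (y¹, u¹): minimizes the (c̃, α̃)-part over tuples feasible with (x¹, η¹)
    (y1 : S.Node → Fin J → ℝ) (u1 : S.Node → ℝ)
    (h2feas : MFeasR S f c A B d (fun n i => (x1 n i : ℝ)) y1 eta1 u1)
    (h2opt : ∀ (y : S.Node → Fin J → ℝ) (u : S.Node → ℝ),
      MFeasR S f c A B d (fun n i => (x1 n i : ℝ)) y eta1 u →
      (∑ n, p n * ((∑ j, (if n = S.root then c 1 j
                          else (1 - lam (S.stage n)) * c (S.stage n) j) * y1 n j)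
          + (if n = S.root then 0 else lam (S.stage n) / (1 - alpha (S.stage n))) * u1 n))
      ≤ ∑ n, p n * ((∑ j, (if n = S.root then c 1 j
                          else (1 - lam (S.stage n)) * c (S.stage n) j) * y n j)
          + (if n = S.root then 0 else lam (S.stage n) / (1 - alpha (S.stage n))) * u n)) :
    MFeasR S f c A B d (fun n i => (x1 n i : ℝ)) y1 eta1 u1 ∧
    zMS S p f c A B d lam alpha
      ≤ FR S p f c lam alpha (fun n i => (x1 n i : ℝ)) y1 eta1 u1 ∧
    FR S p f c lam alpha (fun n i => (x1 n i : ℝ)) y1 eta1 u1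
      ≤ FR S p f c lam alpha (fun n i => (x0 n i : ℝ)) y0 eta0 u0 := by
  refine ⟨h2feas, csInf_le ⟨0, ?_⟩ ⟨x1, y1, eta1, u1, h2feas, rfl⟩, ?_⟩
  · rintro v ⟨x, y, η, u, hfeas, rfl⟩
    exact FR_nonneg S p f c A B d lam alpha hp hpc hf hc hlam halpha hfeas
  · obtain ⟨hx0, hy0, hu0, hd0, hB0, hη0⟩ := h0
    obtain ⟨hx1, hB1, hη1⟩ := h1feas
    have hG := h1opt x0 eta0 ⟨fun n i => Int.cast_nonneg_iff.mp (hx0 n i), hB0, fun n hn => by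
      have := hη0 n hn
      linarith⟩
    have hY := h2opt y0 u0 ⟨fun n i => Int.cast_nonneg (hx1 n i), hy0, hu0, hd0, hB1,
      fun n hn => by
        have := hη1 n hn
        linarith⟩
    rw [FR_eq_Gobj_add, FR_eq_Gobj_add]
    exact add_le_add hG hY
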